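/- For α, β ∈ (0,1) with α + β = 1, the limit as r → 1⁻ of (f_α * f_β)(r) / (−log(1 − r)) equals 1/(2 Γ(α+1) Γ(β+1)). -/

import Mathlib

open Set Filter Real

/-- The coefficient sequence `g_n(α)` defined by the recurrence
`g_0 = 0`, `g_1 = 1`, `g_{n+2} = (2α g_{n+1} + n g_n)/(n+2)`. -/
noncomputable def g (α : ℝ) : ℕ → ℝ
  | 0 => 0
  | 1 => 1
  | (n + 2) => (2 * α * g α (n + 1) + n * g α n) / (n + 2)

/-- The Hadamard product f_α * f_β restricted to the real interval. -/
noncomputable def hadamardR (α β : ℝ) (r : ℝ) : ℝ :=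
  ∑' n : ℕ, g α n * g β n * r ^ n

/-- Coefficients of `(1-z)^(-α)`. -/
noncomputable def aco (α : ℝ) : ℕ → ℝ
  | 0 => 1
  | (n + 1) => (α + n) / (n + 1) * aco α n

lemma aco_succ (α : ℝ) (n : ℕ) : ((n : ℝ) + 1) * aco α (n + 1) = (α + n) * aco α n := by
  simp only [aco]
  have : (n : ℝ) + 1 ≠ 0 := by positivity
  field_simp

lemma aco_pos {α : ℝ} (h : 0 < α) (n : ℕ) : 0 < aco α n := by
  induction n with
  | zero => simp [aco]
  | succ n ih => simp only [aco]; positivity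

lemma aco_le_one {α : ℝ} (h : 0 < α) (h1 : α < 1) (n : ℕ) : aco α n ≤ 1 := by
  induction n with
  | zero => simp [aco]
  | succ n ih =>
    simp only [aco]
    have h2 : (α + n) / (n + 1) ≤ 1 := by
      rw [div_le_one (by positivity)]; linarith
    have := aco_pos h n
    have h3 : 0 ≤ (α + n) / (n + 1) := by positivity
    nlinarith

lemma aco_sum (α : ℝ) (n : ℕ) : α * ∑ m ∈ Finset.range n, aco α m = n * aco α n := by
  induction n with
  | zero => simp
  | succ n ih =>
    rw [Finset.sum_range_succ, mul_add, ih]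
    push_cast
    rw [aco_succ]; ring

lemma aco_prod (α : ℝ) (n : ℕ) :
    ∏ j ∈ Finset.range n, (α + j) = aco α n * (n.factorial : ℝ) := by
  induction n with
  | zero => simp [aco]
  | succ n ih =>
    rw [Finset.prod_range_succ, ih, Nat.factorial_succ]
    push_cast
    linear_combination (-(n.factorial : ℝ)) * aco_succ α n

lemma aco_tendsto_succ {α : ℝ} (h : 0 < α) :
    Tendsto (fun n : ℕ => (((n + 1 : ℕ) : ℝ) * aco α (n + 1)) / (n : ℝ) ^ α) atTop
      (nhds (Real.Gamma α)⁻¹) := by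
  have h1 := (Real.GammaSeq_tendsto_Gamma α).inv₀ (Real.Gamma_pos_of_pos h).ne'
  refine h1.congr fun n => ?_
  rw [Real.GammaSeq, aco_prod, Nat.factorial_succ, inv_div]
  have : (n.factorial : ℝ) ≠ 0 := by positivity
  push_cast
  rw [show aco α (n + 1) * (((n : ℝ) + 1) * n.factorial) =
    (((n : ℝ) + 1) * aco α (n + 1)) * n.factorial by ring, mul_div_mul_right _ _ this]

lemma ratio_tendsto (α : ℝ) :
    Tendsto (fun n : ℕ => (n : ℝ) / (n + α)) atTop (nhds 1) :=
  tendsto_natCast_div_add_atTop α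

/-- `e_n = n a_n`. -/
noncomputable def eco (α : ℝ) (n : ℕ) : ℝ := n * aco α n

lemma eco_succ (α : ℝ) (n : ℕ) : eco α (n + 1) = (n + α) * aco α n := by
  have := aco_succ α n
  simp only [eco]; push_cast; linarith

lemma eco_tendsto {α : ℝ} (h : 0 < α) :
    Tendsto (fun n : ℕ => eco α n / (n : ℝ) ^ α) atTop (nhds (Real.Gamma α)⁻¹) := by
  have := (ratio_tendsto α).mul (aco_tendsto_succ h)
  rw [one_mul] at this
  refine this.congr fun n => ?_
  have h1 := eco_succ α n
  simp only [eco] at h1 ⊢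
  rw [h1]
  have : (n : ℝ) + α ≠ 0 := by positivity
  field_simp

lemma eco_pos {α : ℝ} (h : 0 < α) {n : ℕ} (hn : 0 < n) : 0 < eco α n := by
  have := aco_pos h n
  simp only [eco]; positivity

lemma eco_nonneg {α : ℝ} (h : 0 < α) (n : ℕ) : 0 ≤ eco α n := by
  have := aco_pos h n
  simp only [eco]; positivity

lemma eco_mono {α : ℝ} (h : 0 < α) : Monotone (eco α) := by
  refine monotone_nat_of_le_succ fun n => ?_
  rw [eco_succ, eco]
  have := aco_pos h n
  nlinarith

lemma eco_tendsto_atTop {α : ℝ} (h : 0 < α) : Tendsto (eco α) atTop atTop := by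
  have h1 : Tendsto (fun n : ℕ => (n : ℝ) ^ α) atTop atTop :=
    (tendsto_rpow_atTop h).comp tendsto_natCast_atTop_atTop
  have h2 := (eco_tendsto h).pos_mul_atTop (inv_pos.2 (Real.Gamma_pos_of_pos h)) h1
  refine h2.congr' ?_
  filter_upwards [eventually_gt_atTop 0] with n hn
  have : (n : ℝ) ^ α ≠ 0 := by positivity
  field_simp

lemma eco_ratio_one {α : ℝ} (h : 0 < α) :
    Tendsto (fun n : ℕ => eco α n / eco α (n + 1)) atTop (nhds 1) := by
  refine (ratio_tendsto α).congr fun n => ?_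
  rw [eco_succ, eco]
  have := aco_pos h n
  rw [mul_div_mul_right _ _ this.ne']

lemma eco_ratio {α : ℝ} (h : 0 < α) (k : ℕ) :
    Tendsto (fun n : ℕ => eco α (n - k) / eco α n) atTop (nhds 1) := by
  rw [← tendsto_add_atTop_iff_nat k]
  simp only [Nat.add_sub_cancel]
  induction k with
  | zero =>
    refine tendsto_const_nhds.congr' ?_
    filter_upwards [eventually_gt_atTop 0] with n hn
    exact (div_self (eco_pos h hn).ne').symm
  | succ k ih =>
    have h2 := ih.mul ((eco_ratio_one h).comp (tendsto_add_atTop_nat k))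
    rw [one_mul] at h2
    refine h2.congr' ?_
    filter_upwards [eventually_gt_atTop 0] with n hn
    have := eco_pos h (show 0 < n + k by omega)
    simp only [Function.comp]
    rw [← add_assoc]
    field_simp

/-- Coefficients of `(1+z)^α`. -/
noncomputable def cco (α : ℝ) (n : ℕ) : ℝ := Ring.choose α n

lemma cco_zero (α : ℝ) : cco α 0 = 1 := by simp [cco]

lemma cco_succ (α : ℝ) (n : ℕ) : ((n : ℝ) + 1) * cco α (n + 1) = (α - n) * cco α n := by
  have := Ring.choose_smul_choose α (Nat.le_succ n)
  simp at this
  simp only [cco]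
  linarith

/-- `d_k = k |c_k|`. -/
noncomputable def dco (α : ℝ) (n : ℕ) : ℝ := n * |cco α n|

lemma dco_succ {α : ℝ} (h1 : α < 1) (n : ℕ) (hn : 1 ≤ n) :
    dco α (n + 1) = dco α n - α * |cco α n| := by
  have h := congrArg abs (cco_succ α n)
  rw [abs_mul, abs_mul, abs_of_pos (show (0 : ℝ) < n + 1 by positivity),
    abs_of_neg (show α - n < 0 by
      have : (1 : ℝ) ≤ n := by exact_mod_cast hn
      linarith)] at h
  simp only [dco]; push_cast
  linarith

lemma dco_nonneg (α : ℝ) (n : ℕ) : 0 ≤ dco α n := by simp only [dco]; positivity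

lemma cco_sum_le {α : ℝ} (h1 : α < 1) (n : ℕ) :
    α * ∑ k ∈ Finset.range n, |cco α (k + 1)| = dco α 1 - dco α (n + 1) := by
  induction n with
  | zero => simp
  | succ n ih =>
    rw [Finset.sum_range_succ, mul_add, ih, dco_succ h1 (n + 1) (by omega)]; ring

lemma cco_summable_abs {α : ℝ} (h : 0 < α) (h1 : α < 1) : Summable (fun k => |cco α k|) := by
  rw [← summable_nat_add_iff 1]
  refine summable_of_sum_range_le (c := dco α 1 / α) (fun n => abs_nonneg _) fun n => ?_
  rw [le_div_iff₀ h]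
  have := cco_sum_le h1 n
  have := dco_nonneg α (n + 1)
  linarith

lemma dco_anti {α : ℝ} (h : 0 < α) (h1 : α < 1) : Antitone (fun n => dco α (n + 1)) := by
  refine antitone_nat_of_succ_le fun n => ?_
  rw [dco_succ h1 (n + 1) (by omega)]
  have := abs_nonneg (cco α (n + 1))
  nlinarith

lemma dco_tendsto {α : ℝ} (h : 0 < α) (h1 : α < 1) : Tendsto (dco α) atTop (nhds 0) := by
  rw [← tendsto_add_atTop_iff_nat 1]
  have hb : BddBelow (Set.range (fun n => dco α (n + 1))) :=
    ⟨0, by rintro _ ⟨n, rfl⟩; exact dco_nonneg _ _⟩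
  have hl := tendsto_atTop_ciInf (dco_anti h h1) hb
  set L := ⨅ n, dco α (n + 1) with hL
  have hLn : ∀ n, L ≤ dco α (n + 1) := fun n => ciInf_le hb n
  have hL0 : 0 ≤ L := le_ciInf fun n => dco_nonneg _ _
  rcases hL0.eq_or_lt with h0 | h0
  · rwa [← h0] at hl
  · exfalso
    have hs := (summable_nat_add_iff 1).2 (cco_summable_abs h h1)
    have hs2 : Summable (fun n : ℕ => L * (1 / ((n + 1 : ℕ) : ℝ))) := by
      refine hs.of_nonneg_of_le (fun n => by positivity) fun n => ?_
      have := hLn n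
      simp only [dco] at this
      rw [mul_one_div, div_le_iff₀ (by positivity)]
      linarith
    rw [summable_mul_left_iff h0.ne'] at hs2
    exact Real.not_summable_one_div_natCast ((summable_nat_add_iff 1).1 hs2)

lemma cco_tsum {α : ℝ} (h : 0 < α) (h1 : α < 1) : ∑' k, cco α k = 2 ^ α := by
  have hs : Summable (cco α) := (cco_summable_abs h h1).of_abs
  have h2 := Real.tendsto_tsum_powerSeries_nhdsWithin_lt hs.hasSum.tendsto_sum_nat
  have h3 : Tendsto (fun x : ℝ => (1 + x) ^ α) (nhdsWithin 1 (Set.Iio 1)) (nhds (2 ^ α)) := by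
    have : ContinuousAt (fun x : ℝ => (1 + x) ^ α) 1 :=
      ContinuousAt.rpow_const (by fun_prop) (Or.inl (by norm_num))
    have := this.tendsto.mono_left (nhdsWithin_le_nhds (s := Set.Iio 1))
    norm_num at this
    exact this
  refine tendsto_nhds_unique h2 (h3.congr' ?_)
  have : Set.Ioo (0 : ℝ) 1 ∈ nhdsWithin (1 : ℝ) (Set.Iio 1) := Ioo_mem_nhdsLT (by norm_num)
  filter_upwards [this] with x hx
  have h4 := (Real.one_add_rpow_hasFPowerSeriesOnBall_zero (a := α)).hasSum (y := x)
    (by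
      simp only [Metric.mem_eball, edist_zero_right]
      rw [← ofReal_norm, ENNReal.ofReal_lt_one, Real.norm_eq_abs, abs_of_pos hx.1]
      exact hx.2)
  simp only [zero_add] at h4
  rw [← h4.tsum_eq]
  refine tsum_congr fun n => ?_
  rw [binomialSeries_apply]
  simp [cco]

/-- Coefficients of `((1+z)/(1-z))^α`. -/
noncomputable def hco (α : ℝ) (n : ℕ) : ℝ :=
  ∑ p ∈ Finset.HasAntidiagonal.antidiagonal n, cco α p.1 * aco α p.2

lemma hco_rec (α : ℝ) (n : ℕ) :
    ((n : ℝ) + 2) * hco α (n + 2) = 2 * α * hco α (n + 1) + n * hco α n := by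
  let C : PowerSeries ℝ := PowerSeries.mk (cco α)
  let A : PowerSeries ℝ := PowerSeries.mk (aco α)
  let D := PowerSeries.derivative ℝ
  have hC : (1 + PowerSeries.X) * D C = PowerSeries.C α * C := by
    ext m
    rw [add_mul, one_mul, map_add, PowerSeries.coeff_C_mul]
    cases m with
    | zero =>
      have := cco_succ α 0
      simp [D, C, PowerSeries.coeff_derivative] at this ⊢
      linarith
    | succ m =>
      have := cco_succ α (m + 1)
      rw [PowerSeries.coeff_succ_X_mul]
      simp only [D, C, PowerSeries.coeff_derivative, PowerSeries.coeff_mk]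
      push_cast at this ⊢
      linarith
  have hA : (1 - PowerSeries.X) * D A = PowerSeries.C α * A := by
    ext m
    rw [sub_mul, one_mul, map_sub, PowerSeries.coeff_C_mul]
    cases m with
    | zero =>
      have := aco_succ α 0
      simp [D, A, PowerSeries.coeff_derivative] at this ⊢
      linarith
    | succ m =>
      have := aco_succ α (m + 1)
      rw [PowerSeries.coeff_succ_X_mul]
      simp only [D, A, PowerSeries.coeff_derivative, PowerSeries.coeff_mk]
      push_cast at this ⊢
      linarith
  have hD : D (C * A) = C * D A + A * D C := by
    simp [D, Derivation.leibniz]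
  have hH : D (C * A) - PowerSeries.X ^ 2 * D (C * A) = PowerSeries.C (2 * α) * (C * A) := by
    rw [hD, map_mul]
    have h2 : (PowerSeries.C (2 : ℝ)) = 2 := map_ofNat _ 2
    rw [h2]
    linear_combination (1 + PowerSeries.X) * C * hA + (1 - PowerSeries.X) * A * hC
  have hcoef : ∀ m, PowerSeries.coeff m (C * A) = hco α m := by
    intro m
    simp [PowerSeries.coeff_mul, hco, C, A]
  have := congrArg (PowerSeries.coeff (n + 1)) hH
  rw [map_sub, PowerSeries.coeff_C_mul, PowerSeries.coeff_X_pow_mul'] at this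
  simp only [D, PowerSeries.coeff_derivative, hcoef] at this
  cases n with
  | zero =>
    norm_num at this ⊢
    linarith
  | succ n =>
    rw [if_pos (by omega)] at this
    rw [show n + 1 + 1 - 2 = n by omega] at this
    push_cast at this ⊢
    linarith

lemma hco_eq (α : ℝ) (n : ℕ) : hco α (n + 1) = 2 * α * g α (n + 1) := by
  have h0 : hco α 0 = 1 := by simp [hco, cco_zero, aco]
  have h1 : hco α 1 = 2 * α := by
    have := cco_succ α 0
    simp [cco_zero] at this
    simp [hco, cco_zero, aco, this, Finset.Nat.antidiagonal_succ]
    ring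
  induction n using Nat.strong_induction_on with
  | _ n ih =>
    match n, ih with
    | 0, _ => simp [h1, g]
    | 1, _ =>
      have := hco_rec α 0
      simp [g, h1] at this ⊢
      linarith
    | n + 2, ih =>
      have h2 := hco_rec α (n + 1)
      have e1 := ih n (by omega)
      have e2 := ih (n + 1) (by omega)
      rw [g]
      rw [show n + 1 + 2 = n + 2 + 1 by ring, show n + 1 + 1 + 0 = n + 2 by ring] at h2
      have hp : ((n : ℝ) + 1 + 2) ≠ 0 := by positivity
      push_cast at h2 ⊢
      rw [e1, e2] at h2
      field_simp
      linarith

lemma hco_split (α : ℝ) (n : ℕ) : n * hco α n =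
    (∑ k ∈ Finset.range (n + 1), (k * cco α k) * aco α (n - k)) +
    ∑ k ∈ Finset.range (n + 1), cco α k * eco α (n - k) := by
  rw [hco, Finset.Nat.sum_antidiagonal_eq_sum_range_succ (fun i j => cco α i * aco α j),
    Finset.mul_sum, ← Finset.sum_add_distrib]
  refine Finset.sum_congr rfl fun k hk => ?_
  have : k ≤ n := by simpa [Nat.lt_succ_iff] using hk
  rw [eco, Nat.cast_sub this]; ring

lemma second_part {α : ℝ} (h : 0 < α) (h1 : α < 1) :
    Tendsto (fun n : ℕ => (∑ k ∈ Finset.range (n + 1), cco α k * eco α (n - k)) / eco α n)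
      atTop (nhds (2 ^ α)) := by
  rw [← cco_tsum h h1]
  have key : Tendsto (fun n : ℕ => ∑' k, cco α k * (eco α (n - k) / eco α n)) atTop
      (nhds (∑' k, cco α k)) := by
    refine tendsto_tsum_of_dominated_convergence (bound := fun k => |cco α k|)
      (cco_summable_abs h h1) (fun k => ?_) (Eventually.of_forall fun n k => ?_)
    · simpa using (eco_ratio h k).const_mul (cco α k)
    · have := eco_nonneg h n
      have h3 := eco_nonneg h (n - k)
      rw [norm_mul, Real.norm_eq_abs, Real.norm_of_nonneg (by positivity)]
      exact mul_le_of_le_one_right (abs_nonneg _)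
        (div_le_one_of_le₀ (eco_mono h (Nat.sub_le n k)) this)
  refine key.congr fun n => ?_
  rw [tsum_eq_sum (s := Finset.range (n + 1)), Finset.sum_div]
  · exact Finset.sum_congr rfl fun k _ => by rw [mul_div_assoc]
  · intro k hk
    have : n - k = 0 := by simp at hk; omega
    rw [this]; simp [eco]

lemma first_bound {α : ℝ} (h : 0 < α) (h1 : α < 1) (ε : ℝ) (hε : 0 < ε) (K : ℕ)
    (hK : ∀ k ≥ K, dco α k ≤ ε) (n : ℕ) :
    ∑ k ∈ Finset.range (n + 1), dco α k * aco α (n - k) ≤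
      ∑ k ∈ Finset.range K, dco α k + ε * (eco α (n + 1) / α) := by
  have e1 : eco α (n + 1) / α = ∑ k ∈ Finset.range (n + 1), aco α (n - k) := by
    rw [eco, ← aco_sum, mul_div_cancel_left₀ _ h.ne', ← Finset.sum_range_reflect]
    simp
  rw [e1, Finset.mul_sum]
  have : ∀ k ∈ Finset.range (n + 1), dco α k * aco α (n - k) ≤
      (if k < K then dco α k else 0) + ε * aco α (n - k) := by
    intro k _
    have p := aco_pos h (n - k)
    have q := aco_le_one h h1 (n - k)
    have d := dco_nonneg α k
    split_ifs with hk
    · nlinarith [mul_pos hε p]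
    · have := hK k (by omega)
      nlinarith
  refine (Finset.sum_le_sum this).trans ?_
  rw [Finset.sum_add_distrib]
  gcongr
  rw [← Finset.sum_filter]
  refine Finset.sum_le_sum_of_subset_of_nonneg ?_ fun k _ _ => dco_nonneg _ _
  intro k hk
  simp at hk ⊢
  exact hk.2

lemma first_part {α : ℝ} (h : 0 < α) (h1 : α < 1) :
    Tendsto (fun n : ℕ => (∑ k ∈ Finset.range (n + 1), (k * cco α k) * aco α (n - k)) / eco α n)
      atTop (nhds 0) := by
  rw [Metric.tendsto_atTop']
  intro ε hε
  obtain ⟨K, hK⟩ := eventually_atTop.1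
    ((dco_tendsto h h1).eventually (ge_mem_nhds (show 0 < ε * α / 8 by positivity)))
  set S := ∑ k ∈ Finset.range K, dco α k with hS
  have hS0 : 0 ≤ S := Finset.sum_nonneg fun k _ => dco_nonneg _ _
  obtain ⟨N, hN⟩ := eventually_atTop.1 ((eco_tendsto_atTop h).eventually_gt_atTop (2 * S / ε))
  refine ⟨max N 1, fun n hn => ?_⟩
  have hn1 : 1 < n := lt_of_le_of_lt (le_max_right _ _) hn
  have hnN : N ≤ n := (lt_of_le_of_lt (le_max_left _ _) hn).le
  have hp := eco_pos h (show 0 < n by omega)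
  rw [dist_zero_right, norm_div, Real.norm_of_nonneg hp.le, div_lt_iff₀ hp]
  have hb : ‖∑ k ∈ Finset.range (n + 1), (k * cco α k) * aco α (n - k)‖ ≤
      ∑ k ∈ Finset.range (n + 1), dco α k * aco α (n - k) := by
    refine (norm_sum_le _ _).trans (le_of_eq (Finset.sum_congr rfl fun k _ => ?_))
    rw [norm_mul, norm_mul, Real.norm_natCast, Real.norm_of_nonneg (aco_pos h _).le,
      Real.norm_eq_abs, dco]
  have hb2 := first_bound h h1 _ (show 0 < ε * α / 8 by positivity) K hK n
  have hb3 : eco α (n + 1) ≤ 2 * eco α n := by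
    rw [eco_succ, eco]
    have := aco_pos h n
    have : (1 : ℝ) ≤ n := by exact_mod_cast hn1.le
    nlinarith
  have hb4 := hN n hnN
  rw [div_lt_iff₀ hε] at hb4
  have hb5 : ε * α / 8 * (eco α (n + 1) / α) = ε / 8 * eco α (n + 1) := by field_simp
  rw [hb5] at hb2
  nlinarith

lemma g_tendsto {α : ℝ} (h : 0 < α) (h1 : α < 1) :
    Tendsto (fun n : ℕ => (n : ℝ) * g α n / (n : ℝ) ^ α) atTop
      (nhds (2 ^ α / (2 * Real.Gamma (α + 1)))) := by
  have h2 := ((first_part h h1).add (second_part h h1)).mul (eco_tendsto h)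
  have h3 := h2.const_mul (1 / (2 * α))
  have hG := (Real.Gamma_pos_of_pos h).ne'
  have : 1 / (2 * α) * ((0 + 2 ^ α) * (Real.Gamma α)⁻¹) = 2 ^ α / (2 * Real.Gamma (α + 1)) := by
    rw [Real.Gamma_add_one h.ne']
    field_simp
    ring
  rw [this] at h3
  refine h3.congr' ?_
  filter_upwards [eventually_gt_atTop 0] with n hn
  rw [← add_div, ← hco_split]
  obtain ⟨m, rfl⟩ : ∃ m, n = m + 1 := ⟨n - 1, by omega⟩
  rw [hco_eq]
  have := (eco_pos h hn).ne'
  field_simp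

lemma prod_tendsto {α β : ℝ} (hα : α ∈ Set.Ioo (0:ℝ) 1) (hβ : β ∈ Set.Ioo (0:ℝ) 1)
    (hαβ : α + β = 1) :
    Tendsto (fun n : ℕ => (n : ℝ) * (g α n * g β n)) atTop
      (nhds (1 / (2 * Real.Gamma (α + 1) * Real.Gamma (β + 1)))) := by
  have h := (g_tendsto hα.1 hα.2).mul (g_tendsto hβ.1 hβ.2)
  have e : (2:ℝ) ^ α / (2 * Real.Gamma (α + 1)) * (2 ^ β / (2 * Real.Gamma (β + 1))) =
      1 / (2 * Real.Gamma (α + 1) * Real.Gamma (β + 1)) := by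
    rw [div_mul_div_comm, ← Real.rpow_add (by norm_num), hαβ, Real.rpow_one]
    have a1 := (Real.Gamma_pos_of_pos (show 0 < α + 1 by linarith [hα.1])).ne'
    have a2 := (Real.Gamma_pos_of_pos (show 0 < β + 1 by linarith [hβ.1])).ne'
    field_simp
  rw [e] at h
  refine h.congr' ?_
  filter_upwards [eventually_gt_atTop 0] with n hn
  have hn' : (0 : ℝ) < n := by exact_mod_cast hn
  rw [div_mul_div_comm, ← Real.rpow_add hn', hαβ, Real.rpow_one]
  field_simp

lemma abel_log (p : ℕ → ℝ) (L : ℝ) (hp0 : p 0 = 0)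
    (hp : Tendsto (fun n : ℕ => (n : ℝ) * p n) atTop (nhds L)) :
    Tendsto (fun r : ℝ => (∑' n : ℕ, p n * r ^ n) / (-Real.log (1 - r)))
      (nhdsWithin 1 (Set.Iio 1)) (nhds L) := by
  have hlog : Tendsto (fun r : ℝ => -Real.log (1 - r)) (nhdsWithin 1 (Set.Iio 1)) atTop := by
    refine tendsto_neg_atBot_atTop.comp (Real.tendsto_log_nhdsGT_zero.comp ?_)
    refine tendsto_nhdsWithin_iff.2 ⟨?_, ?_⟩
    · have : ContinuousAt (fun r : ℝ => 1 - r) 1 := by fun_prop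
      have := this.tendsto.mono_left (nhdsWithin_le_nhds (s := Set.Iio 1))
      simpa using this
    · filter_upwards [self_mem_nhdsWithin] with r hr
      simpa using hr
  let δ : ℕ → ℝ := fun n => ((n + 1 : ℕ) : ℝ) * p (n + 1) - L
  have hδ : Tendsto δ atTop (nhds 0) := by
    have := (((tendsto_add_atTop_iff_nat 1).2 hp).sub_const L)
    simpa [δ] using this
  rw [Metric.tendsto_nhds]
  intro ε hε
  obtain ⟨N, hN⟩ := Metric.tendsto_atTop.1 hδ (ε / 4) (by positivity)
  set S := ∑ k ∈ Finset.range N, |δ k| with hS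
  have hS0 : 0 ≤ S := Finset.sum_nonneg fun k _ => abs_nonneg _
  have hI : Set.Ioo (0 : ℝ) 1 ∈ nhdsWithin (1 : ℝ) (Set.Iio 1) := Ioo_mem_nhdsLT (by norm_num)
  filter_upwards [hI, hlog.eventually_gt_atTop (4 * S / ε), hlog.eventually_gt_atTop 0]
    with r hr hr2 hr3
  have hsum := Real.hasSum_pow_div_log_of_abs_lt_one (x := r)
    (by rw [abs_of_pos hr.1]; exact hr.2)
  set l := -Real.log (1 - r) with hl
  let b : ℕ → ℝ := fun n => (if n < N then |δ n| else 0) + ε / 4 * (r ^ (n + 1) / (n + 1))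
  have hfin : HasSum (fun n => if n < N then |δ n| else 0) S := by
    have := hasSum_sum_of_ne_finset_zero (L := .unconditional ℕ) (f := fun n => if n < N then |δ n| else 0)
      (s := Finset.range N) (fun n hn => by simp at hn; simp; omega)
    convert this using 1
    exact Finset.sum_congr rfl fun k hk => by simp at hk; simp [hk]
  have hb : HasSum b (S + ε / 4 * l) := hfin.add (hsum.mul_left _)
  have hle : ∀ n, ‖δ n * (r ^ (n + 1) / (n + 1))‖ ≤ b n := by
    intro n
    have q0 : 0 ≤ r ^ (n + 1) / ((n : ℝ) + 1) := by
      have := hr.1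
      positivity
    have q1 : r ^ (n + 1) / ((n : ℝ) + 1) ≤ 1 := by
      rw [div_le_one (by positivity)]
      have : r ^ (n + 1) ≤ 1 := pow_le_one₀ hr.1.le hr.2.le
      have : (0 : ℝ) ≤ n := by positivity
      linarith
    rw [norm_mul, Real.norm_of_nonneg q0, Real.norm_eq_abs]
    simp only [b]
    have := abs_nonneg (δ n)
    split_ifs with hn
    · nlinarith
    · have := hN n (by omega)
      rw [dist_zero_right, Real.norm_eq_abs] at this
      nlinarith
  have hsδ : Summable (fun n => δ n * (r ^ (n + 1) / (n + 1))) :=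
    Summable.of_norm_bounded hb.summable hle
  have hbd : ‖∑' n, δ n * (r ^ (n + 1) / (n + 1))‖ ≤ S + ε / 4 * l :=
    tsum_of_norm_bounded hb hle
  have hs1 := (hsum.mul_left L).add hsδ.hasSum
  have hs2 : HasSum (fun n => p (n + 1) * r ^ (n + 1))
      (L * l + ∑' n, δ n * (r ^ (n + 1) / (n + 1))) := by
    refine hs1.congr_fun fun n => ?_
    simp only [δ]
    push_cast
    have : (n : ℝ) + 1 ≠ 0 := by positivity
    field_simp
    ring
  have hs3 := (hasSum_nat_add_iff (f := fun n => p n * r ^ n) 1).1 hs2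
  simp [hp0] at hs3
  rw [hs3.tsum_eq, Real.dist_eq, add_div, mul_div_cancel_right₀ _ hr3.ne', add_sub_cancel_left,
    abs_div, abs_of_pos hr3, div_lt_iff₀ hr3]
  rw [Real.norm_eq_abs] at hbd
  rw [div_lt_iff₀ hε] at hr2
  nlinarith

theorem stmt12 (α β : ℝ) (hα : α ∈ Set.Ioo (0:ℝ) 1) (hβ : β ∈ Set.Ioo (0:ℝ) 1)
    (hαβ : α + β = 1) :
    Tendsto (fun r : ℝ => hadamardR α β r / (-Real.log (1 - r)))
      (nhdsWithin 1 (Set.Iio 1))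
      (nhds (1 / (2 * Real.Gamma (α + 1) * Real.Gamma (β + 1)))) := by
  exact abel_log (fun n => g α n * g β n) _ (by simp [g]) (prod_tendsto hα hβ hαβ)
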